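/- arXiv:0803.0998 — 3 statements merged into one kernel-verified Lean document; each statement's English description precedes it below -/
import Mathlib

section
/- Let R be a commutative noetherian ring, C a semidualizing R-module, and M an R-module. The following are equivalent: (i) M is C-flat C-cotorsion, i.e. M ≅ F ⊗_R C for some flat cotorsion R-module F; (ii) M is C-flat and Ext_R^i(N, M) = 0 for every C-flat R-module N and every i ≥ 1; (iii) Hom_R(C,M) is flat and cotorsion and M lies in the Bass class B_C(R). In particular, Ext_R^i(N, W) = 0 whenever N is C-flat, W is C-flat C-cotorsion, and i ≥ 1. -/
open CategoryTheory TensorProduct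

universe u

section
variable (R : Type u) [CommRing R]

def extZero (M N : ModuleCat.{u} R) : Prop :=
  ∀ i : ℕ, 1 ≤ i → Subsingleton (((Ext R (ModuleCat.{u} R) i).obj (Opposite.op M)).obj N)

def torZero (M N : ModuleCat.{u} R) : Prop :=
  ∀ i : ℕ, 1 ≤ i → Subsingleton (((Tor (ModuleCat.{u} R) i).obj M).obj N)

def IsSemidualizing (C : ModuleCat.{u} R) : Prop :=
  Module.Finite R C ∧ Function.Bijective (LinearMap.lsmul R C) ∧ extZero R C C

/-- A module is `C`-flat if it is isomorphic to `F ⊗[R] C` with `F` flat. -/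
def IsCFlat (C M : ModuleCat.{u} R) : Prop :=
  ∃ F : ModuleCat.{u} R, Module.Flat R F ∧ Nonempty (M ≃ₗ[R] (F ⊗[R] C))

def IsCInjective (C M : ModuleCat.{u} R) : Prop :=
  ∃ I : ModuleCat.{u} R, Module.Injective R I ∧ Nonempty (M ≃ₗ[R] (↥C →ₗ[R] ↥I))

/-- cotorsion: `Ext^{≥1}(F, N) = 0` for all flat `F`. -/
def IsCotorsion (N : ModuleCat.{u} R) : Prop :=
  ∀ F : ModuleCat.{u} R, Module.Flat R F → extZero R F N

/-- `C`-cotorsion: `Ext^{≥1}(F ⊗ C, N) = 0` for all flat `F`. -/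
def IsCCotorsion (C N : ModuleCat.{u} R) : Prop :=
  ∀ F : ModuleCat.{u} R, Module.Flat R F →
    extZero R (ModuleCat.of R (↥F ⊗[R] ↥C)) N

/-- `C`-flat `C`-cotorsion: isomorphic to `F ⊗ C` with `F` flat and cotorsion. -/
def IsCFlatCotorsion (C M : ModuleCat.{u} R) : Prop :=
  ∃ F : ModuleCat.{u} R, Module.Flat R F ∧ IsCotorsion R F ∧
    Nonempty (M ≃ₗ[R] (F ⊗[R] C))

/-- The natural evaluation map `C ⊗ Hom(C,M) → M`. -/
noncomputable def evalMap (C M : ModuleCat.{u} R) :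
    (↥C ⊗[R] (↥C →ₗ[R] ↥M)) →ₗ[R] ↥M :=
  TensorProduct.lift (LinearMap.id (R := R) (M := ↥C →ₗ[R] ↥M)).flip

/-- The Bass class `B_C(R)`. -/
noncomputable def InBassClass (C M : ModuleCat.{u} R) : Prop :=
  extZero R C M ∧
  torZero R C (ModuleCat.of R (↥C →ₗ[R] ↥M)) ∧
  Function.Bijective (evalMap R C M)

/-- A `ℤ`-indexed complex of `R`-modules: `d i : X (i+1) → X i`. -/
structure ZComplex where
  X : ℤ → ModuleCat.{u} R
  d : ∀ i : ℤ, ↥(X (i + 1)) →ₗ[R] ↥(X i)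
  d_comp_d : ∀ i : ℤ, (d i).comp (d (i + 1)) = 0

namespace ZComplex

variable {R} (Z : ZComplex R)

/-- Exactness of the complex. -/
def IsExact : Prop := ∀ i : ℤ, Function.Exact (Z.d (i + 1)) (Z.d i)

/-- Exactness of `Z ⊗[R] J`. -/
def TensorExact (J : ModuleCat.{u} R) : Prop :=
  ∀ i : ℤ, Function.Exact (LinearMap.rTensor (↥J) (Z.d (i + 1)))
    (LinearMap.rTensor (↥J) (Z.d i))

/-- Exactness of `Hom_R(V, Z)`. -/
def HomFromExact (V : ModuleCat.{u} R) : Prop :=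
  ∀ i : ℤ, Function.Exact
    (fun f : ↥V →ₗ[R] ↥(Z.X (i + 1 + 1)) => (Z.d (i + 1)).comp f)
    (fun f : ↥V →ₗ[R] ↥(Z.X (i + 1)) => (Z.d i).comp f)

/-- Exactness of `Hom_R(Z, V)`. -/
def HomToExact (V : ModuleCat.{u} R) : Prop :=
  ∀ i : ℤ, Function.Exact
    (fun g : ↥(Z.X i) →ₗ[R] ↥V => g.comp (Z.d i))
    (fun g : ↥(Z.X (i + 1)) →ₗ[R] ↥V => g.comp (Z.d (i + 1)))

/-- `M ≅ Coker(∂₁)`. -/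
def IsCokerOfD1 (M : ModuleCat.{u} R) : Prop :=
  Nonempty (↥M ≃ₗ[R] (↥(Z.X 0) ⧸ LinearMap.range (Z.d 0)))

end ZComplex

end

section
variable (R : Type u) [CommRing R]

/-- A complete `FF_C`-resolution witnessing that `M` is `G_C`-flat. -/
def IsGCFlat (C M : ModuleCat.{u} R) : Prop :=
  ∃ Z : ZComplex R, Z.IsExact ∧
    (∀ i : ℤ, 0 ≤ i → Module.Flat R (Z.X i)) ∧
    (∀ i : ℤ, i < 0 → IsCFlat R C (Z.X i)) ∧
    (∀ J : ModuleCat.{u} R, IsCInjective R C J → Z.TensorExact J) ∧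
    Z.IsCokerOfD1 M

def IsCProjective (C M : ModuleCat.{u} R) : Prop :=
  ∃ P : ModuleCat.{u} R, Module.Projective R P ∧ Nonempty (M ≃ₗ[R] (P ⊗[R] C))

/-- A complete `PP_C`-resolution witnessing that `M` is `G_C`-projective. -/
def IsGCProjective (C M : ModuleCat.{u} R) : Prop :=
  ∃ Z : ZComplex R, Z.IsExact ∧
    (∀ i : ℤ, 0 ≤ i → Module.Projective R (Z.X i)) ∧
    (∀ i : ℤ, i < 0 → IsCProjective R C (Z.X i)) ∧
    (∀ Q : ModuleCat.{u} R, IsCProjective R C Q → Z.HomToExact Q) ∧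
    Z.IsCokerOfD1 M

/-- `G(𝒳)` for a class `𝒳` of modules. -/
def GClass (𝒳 : ModuleCat.{u} R → Prop) (M : ModuleCat.{u} R) : Prop :=
  ∃ Z : ZComplex R, Z.IsExact ∧
    (∀ i : ℤ, 𝒳 (Z.X i)) ∧
    (∀ V : ModuleCat.{u} R, 𝒳 V → Z.HomFromExact V) ∧
    (∀ V : ModuleCat.{u} R, 𝒳 V → Z.HomToExact V) ∧
    Z.IsCokerOfD1 M

/-- Iterates `G^n(𝒳)`, with `G^0(𝒳) = 𝒳`. -/
def GIter : ℕ → (ModuleCat.{u} R → Prop) → (ModuleCat.{u} R → Prop)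
  | 0, 𝒳 => 𝒳
  | n + 1, 𝒳 => GClass R (GIter n 𝒳)

/-- `H_C(𝒳)`: modules with a `P_C F_C^cot`-complete `𝒳`-resolution. -/
def HClass (C : ModuleCat.{u} R) (𝒳 : ModuleCat.{u} R → Prop) (M : ModuleCat.{u} R) : Prop :=
  ∃ Z : ZComplex R, Z.IsExact ∧
    (∀ i : ℤ, 𝒳 (Z.X i)) ∧
    (∀ P : ModuleCat.{u} R, Module.Projective R P →
      Z.HomFromExact (ModuleCat.of R (↥P ⊗[R] ↥C))) ∧
    (∀ N : ModuleCat.{u} R, IsCFlatCotorsion R C N → Z.HomToExact N) ∧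
    Z.IsCokerOfD1 M

/-- Iterates `H_C^n(𝒳)`, with `H_C^0(𝒳) = 𝒳`. -/
def HIter (C : ModuleCat.{u} R) : ℕ → (ModuleCat.{u} R → Prop) → (ModuleCat.{u} R → Prop)
  | 0, 𝒳 => 𝒳
  | n + 1, 𝒳 => HClass R C (HIter C n 𝒳)

/-- `M` admits a resolution `0 → X_n → ⋯ → X_0 → M → 0` with each `X_i` in `𝒳`. -/
def HasResOfLength (𝒳 : ModuleCat.{u} R → Prop) (n : ℕ) (M : ModuleCat.{u} R) : Prop :=
  ∃ (P : ℕ → ModuleCat.{u} R) (d : ∀ i : ℕ, ↥(P (i + 1)) →ₗ[R] ↥(P i))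
    (ε : ↥(P 0) →ₗ[R] ↥M),
      Function.Surjective ε ∧ Function.Exact (d 0) ε ∧
      (∀ i : ℕ, Function.Exact (d (i + 1)) (d i)) ∧
      (∀ i : ℕ, i ≤ n → 𝒳 (P i)) ∧
      (∀ i : ℕ, n < i → Subsingleton (P i))

/-- `M` admits a coresolution `0 → M → Y_0 → ⋯ → Y_n → 0` with each `Y_i` in `𝒳`. -/
def HasCoresOfLength (𝒳 : ModuleCat.{u} R → Prop) (n : ℕ) (M : ModuleCat.{u} R) : Prop :=
  ∃ (P : ℕ → ModuleCat.{u} R) (d : ∀ i : ℕ, ↥(P i) →ₗ[R] ↥(P (i + 1)))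
    (η : ↥M →ₗ[R] ↥(P 0)),
      Function.Injective η ∧ Function.Exact η (d 0) ∧
      (∀ i : ℕ, Function.Exact (d i) (d (i + 1))) ∧
      (∀ i : ℕ, i ≤ n → 𝒳 (P i)) ∧
      (∀ i : ℕ, n < i → Subsingleton (P i))

/-- `C` is a dualizing module: semidualizing of finite injective dimension. -/
def IsDualizing (C : ModuleCat.{u} R) : Prop :=
  IsSemidualizing R C ∧
  ∃ n : ℕ, HasCoresOfLength R (fun I => Module.Injective R ↥I) n C

end


namespace CategoryTheory.Abelian

/-- Vanishing of the left derived `Ext` in positive degree agrees with vanishing of the `Ext` of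
the derived category. -/
lemma subsingleton_ext_obj_iff {R : Type u} [CommRing R] (M N : ModuleCat.{u} R) (n : ℕ) :
    Subsingleton (((_root_.Ext R (ModuleCat.{u} R) (n + 1)).obj (Opposite.op M)).obj N) ↔
      Subsingleton (Ext M N (n + 1)) := by
  let P := ProjectiveResolution.of M
  have key : Subsingleton (Ext M N (n + 1)) ↔
      ∀ f : P.complex.X (n + 1) ⟶ N, P.complex.d (n + 2) (n + 1) ≫ f = 0 →
        ∃ g : P.complex.X n ⟶ N, P.complex.d (n + 1) n ≫ g = f := by
    constructor
    · intro h f hf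
      exact (P.extMk_eq_zero_iff f (n + 2) rfl hf n rfl).1 (Subsingleton.elim _ _)
    · intro h
      refine ⟨fun a b => ?_⟩
      rw [← sub_eq_zero]
      obtain ⟨f, hf, he⟩ := P.extMk_surjective (a - b) (n + 2) rfl
      rw [← he, P.extMk_eq_zero_iff _ _ _ _ n rfl]
      exact h f hf
  rw [(P.isoExt (R := R) (n + 1) N).toLinearEquiv.toEquiv.subsingleton_congr,
    ← ModuleCat.isZero_iff_subsingleton, ← HomologicalComplex.exactAt_iff_isZero_homology,
    HomologicalComplex.exactAt_iff' _ n (n + 1) (n + 2) (by simp) (by simp),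
    ShortComplex.moduleCat_exact_iff, key]
  rfl

variable {A : Type*} [Category* A] [Abelian A] [HasExt.{u} A] {S : ShortComplex A}

lemma subsingleton_ext_one_iff (hS : S.ShortExact) (Y : A) [Subsingleton (Ext S.X₂ Y 1)] :
    Subsingleton (Ext S.X₃ Y 1) ↔ ∀ f : S.X₁ ⟶ Y, ∃ g : S.X₂ ⟶ Y, S.f ≫ g = f := by
  constructor
  · intro h f
    obtain ⟨x, hx⟩ := Ext.contravariant_sequence_exact₁ hS Y (Ext.mk₀ f) (add_zero 1)
      (Subsingleton.elim _ _)
    obtain ⟨g, rfl⟩ := (Ext.mk₀_bijective _ _).2 x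
    exact ⟨g, (Ext.mk₀_bijective _ _).1 (by rw [← hx, Ext.mk₀_comp_mk₀])⟩
  · intro h
    refine subsingleton_of_forall_eq 0 fun x => ?_
    obtain ⟨y, rfl⟩ := Ext.contravariant_sequence_exact₃ hS Y x (Subsingleton.elim _ _)
      (add_zero 1)
    obtain ⟨f, rfl⟩ := (Ext.mk₀_bijective _ _).2 y
    obtain ⟨g, rfl⟩ := h f
    rw [← Ext.mk₀_comp_mk₀, hS.extClass_comp_assoc]

lemma subsingleton_ext_succ_iff (hS : S.ShortExact) (Y : A) (n : ℕ)
    [Subsingleton (Ext S.X₂ Y n)] [Subsingleton (Ext S.X₂ Y (n + 1))] :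
    Subsingleton (Ext S.X₃ Y (n + 1)) ↔ Subsingleton (Ext S.X₁ Y n) := by
  constructor
  · intro h
    refine subsingleton_of_forall_eq 0 fun x => ?_
    obtain ⟨y, rfl⟩ := Ext.contravariant_sequence_exact₁ hS Y x (add_comm 1 n)
      (Subsingleton.elim _ _)
    rw [Subsingleton.elim y 0, Ext.comp_zero]
  · intro h
    refine subsingleton_of_forall_eq 0 fun x => ?_
    obtain ⟨y, rfl⟩ := Ext.contravariant_sequence_exact₃ hS Y x (Subsingleton.elim _ _)
      (add_comm 1 n)
    rw [Subsingleton.elim y 0, Ext.comp_zero]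

lemma subsingleton_ext_congr {X X' Y Y' : A} (e : X ≅ X') (e' : Y ≅ Y') (n : ℕ) :
    Subsingleton (Ext X Y n) ↔ Subsingleton (Ext X' Y' n) := by
  have key : ∀ {X X' Y Y' : A} (_ : X ≅ X') (_ : Y ≅ Y'), Subsingleton (Ext X Y n) →
      Subsingleton (Ext X' Y' n) := by
    intro X X' Y Y' e e' h
    refine subsingleton_of_forall_eq 0 fun x => ?_
    have h₁ : (Ext.mk₀ e.hom).comp (x.comp (Ext.mk₀ e'.inv) (add_zero n)) (zero_add n) = 0 :=
      Subsingleton.elim _ _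
    have h₂ := congrArg
      (fun y => (Ext.mk₀ e.inv).comp (y.comp (Ext.mk₀ e'.hom) (add_zero n)) (zero_add n)) h₁
    simpa using h₂
  exact ⟨key e e', key e.symm e'.symm⟩

end CategoryTheory.Abelian

section

variable {R : Type u} [CommRing R]

open LinearMap

/-- All higher `Ext` groups from `X` to `Y` vanish. -/
def HigherExtVanishes (R : Type u) [CommRing R] (X Y : Type u) [AddCommGroup X] [Module R X]
    [AddCommGroup Y] [Module R Y] : Prop :=
  ∀ n : ℕ, Subsingleton (Abelian.Ext (ModuleCat.of R X) (ModuleCat.of R Y) (n + 1))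

lemma extZero_iff (M N : ModuleCat.{u} R) : extZero R M N ↔ HigherExtVanishes R M N := by
  constructor
  · intro h n
    exact (Abelian.subsingleton_ext_obj_iff M N n).1 (h (n + 1) (by lia))
  · rintro h (_ | n) hn
    · lia
    · exact (Abelian.subsingleton_ext_obj_iff M N n).2 (h n)

variable {K P X Y : Type u} [AddCommGroup K] [Module R K] [AddCommGroup P] [Module R P]
  [AddCommGroup X] [Module R X] [AddCommGroup Y] [Module R Y]

namespace HigherExtVanishes

lemma congr {X' Y' : Type u} [AddCommGroup X'] [Module R X'] [AddCommGroup Y'] [Module R Y']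
    (e : X ≃ₗ[R] X') (e' : Y ≃ₗ[R] Y') : HigherExtVanishes R X Y ↔ HigherExtVanishes R X' Y' :=
  forall_congr' fun n => Abelian.subsingleton_ext_congr e.toModuleIso e'.toModuleIso (n + 1)

lemma of_projective [Module.Projective R X] : HigherExtVanishes R X Y := by
  have : Projective (ModuleCat.of R X) := (IsProjective.iff_projective (R := R) X).1 inferInstance
  exact fun n => Abelian.Ext.subsingleton_of_projective _ _ _

variable {i : K →ₗ[R] P} {p : P →ₗ[R] X}

lemma subsingleton_ext_one_iff (hP : HigherExtVanishes R P Y) (hi : Function.Injective i)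
    (hp : Function.Surjective p) (hip : Function.Exact i p) :
    Subsingleton (Abelian.Ext (ModuleCat.of R X) (ModuleCat.of R Y) 1) ↔
      Function.Surjective (lcomp R Y i) := by
  have hS := ModuleCat.shortComplex_shortExact
    (ModuleCat.shortComplexOfCompEqZero i p hip.linearMap_comp_eq_zero) hip hi hp
  have := hP 0
  refine (Abelian.subsingleton_ext_one_iff hS _).trans ⟨fun h f => ?_, fun h f => ?_⟩
  · obtain ⟨g, hg⟩ := h (ModuleCat.ofHom f)
    exact ⟨g.hom, congrArg ModuleCat.Hom.hom hg⟩
  · obtain ⟨g, hg⟩ := h f.hom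
    exact ⟨ModuleCat.ofHom g, ModuleCat.hom_ext hg⟩

lemma subsingleton_ext_succ_iff (hP : HigherExtVanishes R P Y) (hi : Function.Injective i)
    (hp : Function.Surjective p) (hip : Function.Exact i p) (n : ℕ) :
    Subsingleton (Abelian.Ext (ModuleCat.of R X) (ModuleCat.of R Y) (n + 2)) ↔
      Subsingleton (Abelian.Ext (ModuleCat.of R K) (ModuleCat.of R Y) (n + 1)) := by
  have hS := ModuleCat.shortComplex_shortExact
    (ModuleCat.shortComplexOfCompEqZero i p hip.linearMap_comp_eq_zero) hip hi hp
  have := hP n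
  have := hP (n + 1)
  exact Abelian.subsingleton_ext_succ_iff hS _ (n + 1)

lemma syzygy (h : HigherExtVanishes R X Y) (hP : HigherExtVanishes R P Y)
    (hi : Function.Injective i) (hp : Function.Surjective p) (hip : Function.Exact i p) :
    HigherExtVanishes R K Y :=
  fun n => (hP.subsingleton_ext_succ_iff hi hp hip n).1 (h (n + 1))

end HigherExtVanishes

/-- The standard free cover of a module. -/
lemma exists_free_surjective (R : Type u) [CommRing R] (X : Type u) [AddCommGroup X]
    [Module R X] : ∃ (P : Type u) (_ : AddCommGroup P) (_ : Module R P) (_ : Module.Free R P)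
      (p : P →ₗ[R] X), Function.Surjective p :=
  ⟨X →₀ R, inferInstance, inferInstance, inferInstance, Finsupp.linearCombination R id,
    Finsupp.linearCombination_id_surjective R X⟩

/-- If the cokernel of an injective map is flat, the map is universally injective. -/
lemma lTensor_injective_of_flat_cokernel (N : Type u) [AddCommGroup N] [Module R N]
    {i : K →ₗ[R] P} {p : P →ₗ[R] X} [Module.Flat R X] (hi : Function.Injective i)
    (hp : Function.Surjective p) (hip : Function.Exact i p) :
    Function.Injective (i.lTensor N) := by
  obtain ⟨E, _, _, _, q, hq⟩ := exists_free_surjective R N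
  have hqe : Function.Exact (ker q).subtype q := exact_subtype_ker_map q
  rw [injective_iff_map_eq_zero]
  intro x hx
  obtain ⟨e, rfl⟩ := rTensor_surjective K hq x
  have comm {A B C D : Type u} [AddCommGroup A] [Module R A] [AddCommGroup B] [Module R B]
      [AddCommGroup C] [Module R C] [AddCommGroup D] [Module R D] (f : A →ₗ[R] B)
      (g : C →ₗ[R] D) (z : A ⊗[R] C) :
      g.lTensor B (f.rTensor C z) = f.rTensor D (g.lTensor A z) := by
    rw [← LinearMap.comp_apply, ← LinearMap.comp_apply, lTensor_comp_rTensor, rTensor_comp_lTensor]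
  obtain ⟨l, hl⟩ := (rTensor_exact P hqe hq _).1 ((comm q i e).symm.trans hx)
  have hl₀ : p.lTensor (ker q) l = 0 := by
    apply Module.Flat.rTensor_preserves_injective_linearMap (M := X) _
      (ker q).injective_subtype
    rw [← comm, hl, map_zero]
    exact (lTensor_exact E hip hp).apply_apply_eq_zero e
  obtain ⟨k, rfl⟩ := (lTensor_exact (ker q) hip hp l).1 hl₀
  rw [← comm] at hl
  rw [← Module.Flat.lTensor_preserves_injective_linearMap (M := E) _ hi hl]
  exact (rTensor_exact K hqe hq).apply_apply_eq_zero k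

lemma Module.Flat.of_exact [Module.Flat R P] {i : K →ₗ[R] P} {p : P →ₗ[R] X} [Module.Flat R X]
    (hi : Function.Injective i) (hp : Function.Surjective p) (hip : Function.Exact i p) :
    Module.Flat R K := by
  rw [Module.Flat.iff_rTensor_injective']
  intro I
  have h₁ := lTensor_injective_of_flat_cokernel I hi hp hip
  have h₂ := Module.Flat.rTensor_preserves_injective_linearMap (M := P) I.subtype
    I.injective_subtype
  have h₃ := h₂.comp h₁
  rw [← coe_comp, rTensor_comp_lTensor, ← lTensor_comp_rTensor, coe_comp] at h₃
  exact Function.Injective.of_comp h₃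


section HomTensor

variable (F : Type u) [AddCommGroup F] [Module R F] (Y)

lemma lTensorHomToHomLTensor_naturality (i : K →ₗ[R] P) (z : F ⊗[R] (P →ₗ[R] Y)) :
    lTensorHomToHomLTensor (.id R) K F Y ((lcomp R Y i).lTensor F z) =
      lcomp R (F ⊗[R] Y) i (lTensorHomToHomLTensor (.id R) P F Y z) := by
  rw [← LinearMap.comp_apply, ← LinearMap.comp_apply]
  congr 1
  ext
  simp

lemma lTensorHomToHomLTensor_bijective_of_projective [Module.Finite R P]
    [Module.Projective R P] :
    Function.Bijective (lTensorHomToHomLTensor (.id R) P F Y) := by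
  rw [← lTensorHomEquivHomLTensor_toLinearMap]
  exact (lTensorHomEquivHomLTensor R P F Y).bijective

variable [Module.Flat R F]

lemma lTensorHomToHomLTensor_injective (X : Type u) [AddCommGroup X] [Module R X]
    [Module.Finite R X] : Function.Injective (lTensorHomToHomLTensor (.id R) X F Y) := by
  obtain ⟨P, _, _, _, _, p, hp⟩ := Module.exists_finite_presentation R X
  have h₁ := Module.Flat.lTensor_preserves_injective_linearMap (M := F) _
    (lcomp_injective_of_surjective (S := R) (N := Y) p hp)
  have h₂ := (lTensorHomToHomLTensor_bijective_of_projective (P := P) Y F).1.comp h₁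
  intro x y hxy
  apply h₂
  simp only [Function.comp_apply, lTensorHomToHomLTensor_naturality, hxy]

lemma lTensorHomToHomLTensor_bijective [IsNoetherianRing R] (X : Type u) [AddCommGroup X]
    [Module R X] [Module.Finite R X] :
    Function.Bijective (lTensorHomToHomLTensor (.id R) X F Y) := by
  refine ⟨lTensorHomToHomLTensor_injective Y F X, fun f => ?_⟩
  obtain ⟨P, _, _, _, _, p, hp⟩ := Module.exists_finite_presentation R X
  have hip : Function.Exact (ker p).subtype p := exact_subtype_ker_map p
  obtain ⟨g, hg⟩ := (lTensorHomToHomLTensor_bijective_of_projective (P := P) Y F).2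
    (lcomp R _ p f)
  have hg₀ : (lcomp R Y (ker p).subtype).lTensor F g = 0 := by
    apply lTensorHomToHomLTensor_injective Y F (ker p)
    rw [lTensorHomToHomLTensor_naturality, hg, map_zero]
    exact (exact_lcomp_of_exact_of_surjective (F ⊗[R] Y) hip hp).apply_apply_eq_zero f
  obtain ⟨z, rfl⟩ :=
    (Module.Flat.lTensor_exact F (exact_lcomp_of_exact_of_surjective Y hip hp) g).1 hg₀
  refine ⟨z, lcomp_injective_of_surjective (S := R) p hp ?_⟩
  rw [← hg, lTensorHomToHomLTensor_naturality]

variable {Y} in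
lemma HigherExtVanishes.tensor_right [IsNoetherianRing R] (X : Type u) [AddCommGroup X]
    [Module R X] [Module.Finite R X] (h : HigherExtVanishes R X Y) :
    HigherExtVanishes R X (F ⊗[R] Y) := by
  intro n
  induction n generalizing X with
  | zero =>
    obtain ⟨P, _, _, _, _, p, hp⟩ := Module.exists_finite_presentation R X
    have hip : Function.Exact (ker p).subtype p := exact_subtype_ker_map p
    have hi := (ker p).injective_subtype
    rw [zero_add, (of_projective (X := P)).subsingleton_ext_one_iff hi hp hip]
    have h₁ := ((of_projective (X := P)).subsingleton_ext_one_iff hi hp hip).1 (h 0)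
    intro f
    obtain ⟨z, rfl⟩ := (lTensorHomToHomLTensor_bijective Y F (ker p)).2 f
    obtain ⟨w, rfl⟩ := lTensor_surjective F h₁ z
    exact ⟨_, (lTensorHomToHomLTensor_naturality Y F _ w).symm⟩
  | succ n ih =>
    obtain ⟨P, _, _, _, _, p, hp⟩ := Module.exists_finite_presentation R X
    have hip : Function.Exact (ker p).subtype p := exact_subtype_ker_map p
    have hi := (ker p).injective_subtype
    rw [(of_projective (X := P)).subsingleton_ext_succ_iff hi hp hip]
    exact ih (ker p) (h.syzygy (of_projective (X := P)) hi hp hip)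

end HomTensor

/-- Tensoring with a projective module on the left preserves vanishing of higher `Ext`. -/
lemma HigherExtVanishes.tensor_left (Q : Type u) [AddCommGroup Q] [Module R Q]
    [Module.Projective R Q] (h : HigherExtVanishes R X Y) :
    HigherExtVanishes R (Q ⊗[R] X) Y := by
  intro n
  induction n generalizing X with
  | zero =>
    obtain ⟨P, _, _, _, p, hp⟩ := exists_free_surjective R X
    have hip : Function.Exact (ker p).subtype p := exact_subtype_ker_map p
    have hi := (ker p).injective_subtype
    have h₁ := ((of_projective (X := P)).subsingleton_ext_one_iff hi hp hip).1 (h 0)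
    rw [zero_add, (of_projective (X := Q ⊗[R] P)).subsingleton_ext_one_iff
      (Module.Flat.lTensor_preserves_injective_linearMap _ hi) (lTensor_surjective Q hp)
      (lTensor_exact Q hip hp)]
    intro f
    obtain ⟨g, hg⟩ := Module.projective_lifting_property _ (TensorProduct.curry f) h₁
    refine ⟨TensorProduct.lift g, TensorProduct.ext' fun q k => ?_⟩
    exact LinearMap.congr_fun (LinearMap.congr_fun hg q) k
  | succ n ih =>
    obtain ⟨P, _, _, _, p, hp⟩ := exists_free_surjective R X
    have hip : Function.Exact (ker p).subtype p := exact_subtype_ker_map p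
    have hi := (ker p).injective_subtype
    rw [(of_projective (X := Q ⊗[R] P)).subsingleton_ext_succ_iff
      (Module.Flat.lTensor_preserves_injective_linearMap _ hi) (lTensor_surjective Q hp)
      (lTensor_exact Q hip hp)]
    exact ih (h.syzygy (of_projective (X := P)) hi hp hip)

/-- If all higher `Ext` from `X` to `Y` vanish, then `Ext (G ⊗ X) Y` and `Ext G (Hom(X, Y))`
vanish in the same positive degrees for flat `G`. -/
lemma HigherExtVanishes.subsingleton_ext_tensor_iff (h : HigherExtVanishes R X Y)
    (G : Type u) [AddCommGroup G] [Module R G] [Module.Flat R G] (n : ℕ) :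
    Subsingleton (Abelian.Ext (ModuleCat.of R (G ⊗[R] X)) (ModuleCat.of R Y) (n + 1)) ↔
      Subsingleton (Abelian.Ext (ModuleCat.of R G) (ModuleCat.of R (X →ₗ[R] Y)) (n + 1)) := by
  induction n generalizing G with
  | zero =>
    obtain ⟨Q, _, _, _, p, hp⟩ := exists_free_surjective R G
    have hip : Function.Exact (ker p).subtype p := exact_subtype_ker_map p
    have hi := (ker p).injective_subtype
    have hi' : Function.Injective ((ker p).subtype.rTensor X) :=
      (lTensor_inj_iff_rTensor_inj _ _).1 (lTensor_injective_of_flat_cokernel X hi hp hip)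
    rw [zero_add, (h.tensor_left Q).subsingleton_ext_one_iff hi' (rTensor_surjective X hp)
      (rTensor_exact X hip hp), (of_projective (X := Q)).subsingleton_ext_one_iff hi hp hip]
    constructor
    · intro hs f
      obtain ⟨g, hg⟩ := hs (TensorProduct.lift f)
      refine ⟨TensorProduct.curry g, LinearMap.ext fun k => LinearMap.ext fun x => ?_⟩
      exact LinearMap.congr_fun hg (k ⊗ₜ x)
    · intro hs f
      obtain ⟨g, hg⟩ := hs (TensorProduct.curry f)
      refine ⟨TensorProduct.lift g, TensorProduct.ext' fun k x => ?_⟩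
      exact LinearMap.congr_fun (LinearMap.congr_fun hg k) x
  | succ n ih =>
    obtain ⟨Q, _, _, _, p, hp⟩ := exists_free_surjective R G
    have hip : Function.Exact (ker p).subtype p := exact_subtype_ker_map p
    have hi := (ker p).injective_subtype
    have hi' : Function.Injective ((ker p).subtype.rTensor X) :=
      (lTensor_inj_iff_rTensor_inj _ _).1 (lTensor_injective_of_flat_cokernel X hi hp hip)
    have := Module.Flat.of_exact hi hp hip
    rw [(h.tensor_left Q).subsingleton_ext_succ_iff hi' (rTensor_surjective X hp)
      (rTensor_exact X hip hp), (of_projective (X := Q)).subsingleton_ext_succ_iff hi hp hip]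
    exact ih (ker p)

/-- A step in a flat resolution: if the image of `d₁` has flat cokernel in a flat module, then
tensoring preserves exactness at the source of `d₁`, and the image of `d₂` again has flat
cokernel. -/
lemma lTensor_exact_of_flat_cokernel (N : Type u) [AddCommGroup N] [Module R N]
    {d₂ : K →ₗ[R] P} {d₁ : P →ₗ[R] X} (h : Function.Exact d₂ d₁) [Module.Flat R X]
    [Module.Flat R (X ⧸ range d₁)] :
    Function.Exact (d₂.lTensor N) (d₁.lTensor N) ∧ Module.Flat R (P ⧸ range d₂) := by
  have hi := (range d₁).injective_subtype
  have hp := (range d₁).mkQ_surjective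
  have hip := exact_subtype_mkQ (range d₁)
  have hr : Function.Exact d₂ d₁.rangeRestrict := fun x => by
    rw [← h x, Subtype.ext_iff]; rfl
  constructor
  · have := (lTensor_exact N hr d₁.surjective_rangeRestrict).comp_injective _
      (lTensor_injective_of_flat_cokernel N hi hp hip) (map_zero _)
    rwa [← coe_comp, ← lTensor_comp] at this
  · have := Module.Flat.of_exact hi hp hip
    rw [← h.linearMap_ker_eq]
    exact Module.Flat.of_linearEquiv d₁.quotKerEquivRange

lemma flat_of_projective_object (M : ModuleCat.{u} R) [Projective M] : Module.Flat R M :=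
  have : Module.Projective R M := (IsProjective.iff_projective (R := R) M).2 inferInstance
  inferInstance

/-- Higher `Tor` vanishes when the second argument is flat. -/
lemma torZero_of_flat (M N : ModuleCat.{u} R) [Module.Flat R N] : torZero R M N := by
  let Q := ProjectiveResolution.of N
  have hflat (n : ℕ) : Module.Flat R (Q.complex.X n) := flat_of_projective_object _
  have hexact (n : ℕ) :
      Function.Exact (Q.complex.d (n + 2) (n + 1)).hom (Q.complex.d (n + 1) n).hom :=
    (ShortComplex.ShortExact.moduleCat_exact_iff_function_exact _).1 (Q.exact_succ n)
  have hcoker (n : ℕ) : Module.Flat R (Q.complex.X n ⧸ range (Q.complex.d (n + 1) n).hom) := by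
    induction n with
    | zero =>
      have h₀ : Function.Exact (Q.complex.d 1 0).hom (Q.π.f 0).hom :=
        (ShortComplex.ShortExact.moduleCat_exact_iff_function_exact _).1 Q.exact₀
      have hs : Function.Surjective (Q.π.f 0).hom := (ModuleCat.epi_iff_surjective _).1 inferInstance
      have : Module.Flat R (((ChainComplex.single₀ (ModuleCat.{u} R)).obj N).X 0) :=
        inferInstanceAs (Module.Flat R N)
      exact Module.Flat.of_linearEquiv (h₀.linearEquivOfSurjective hs)
    | succ n ih => exact (lTensor_exact_of_flat_cokernel M (hexact n)).2
  rintro (_ | n) hn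
  · lia
  refine (Q.isoLeftDerivedObj ((MonoidalCategory.tensoringLeft (ModuleCat.{u} R)).obj M)
    (n + 1)).toLinearEquiv.toEquiv.subsingleton_congr.2 ?_
  refine ModuleCat.isZero_iff_subsingleton.1
    ((HomologicalComplex.exactAt_iff_isZero_homology _ _).1 ?_)
  rw [HomologicalComplex.exactAt_iff' _ (n + 2) (n + 1) n (by simp) (by simp),
    ShortComplex.ShortExact.moduleCat_exact_iff_function_exact]
  exact (lTensor_exact_of_flat_cokernel M (hexact n)).1

section Semidualizing

variable {C : ModuleCat.{u} R} (F : Type u) [AddCommGroup F] [Module R F] [Module.Flat R F]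
  [IsNoetherianRing R]

lemma IsSemidualizing.mk_bijective (hC : IsSemidualizing R C) :
    Function.Bijective (TensorProduct.mk R F C) := by
  have := hC.1
  have h := (lTensorHomToHomLTensor_bijective C F C).comp
    (((LinearEquiv.ofBijective _ hC.2.1).lTensor F).bijective.comp
      (TensorProduct.rid R F).symm.bijective)
  convert h using 1
  ext f c
  simp

/-- For `F` flat and `C` semidualizing, `F` is recovered as `Hom(C, F ⊗ C)`. -/
noncomputable def IsSemidualizing.homTensorEquiv (hC : IsSemidualizing R C) :
    F ≃ₗ[R] (C →ₗ[R] F ⊗[R] C) :=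
  LinearEquiv.ofBijective _ (hC.mk_bijective F)

lemma IsSemidualizing.higherExtVanishes_tensor (hC : IsSemidualizing R C) :
    HigherExtVanishes R C (F ⊗[R] C) :=
  have := hC.1
  ((extZero_iff C C).1 hC.2.2).tensor_right F C

lemma IsSemidualizing.inBassClass_of_equiv (hC : IsSemidualizing R C) {M : ModuleCat.{u} R}
    (e : M ≃ₗ[R] F ⊗[R] C) : InBassClass R C M := by
  let e' : F ≃ₗ[R] (C →ₗ[R] M) := hC.homTensorEquiv F ≪≫ₗ e.symm.congrRight
  refine ⟨(extZero_iff C M).2 ?_, ?_, ?_⟩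
  · exact (HigherExtVanishes.congr (LinearEquiv.refl R C) e).2 (hC.higherExtVanishes_tensor F)
  · have : Module.Flat R (ModuleCat.of R (C →ₗ[R] M)) := Module.Flat.of_linearEquiv e'.symm
    exact torZero_of_flat _ _
  · have h : evalMap R C M = (TensorProduct.congr (LinearEquiv.refl R C) e'.symm ≪≫ₗ
        TensorProduct.comm R C F ≪≫ₗ e.symm).toLinearMap := by
      refine (LinearMap.cancel_right (g := (e'.lTensor C).toLinearMap)
        (e'.lTensor C).surjective).1 ?_
      ext c f
      simp [evalMap, e', homTensorEquiv]
      rfl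
    rw [h]
    exact LinearEquiv.bijective _

lemma IsSemidualizing.isCotorsion_iff (hC : IsSemidualizing R C) {M : ModuleCat.{u} R}
    (e : M ≃ₗ[R] F ⊗[R] C) :
    IsCotorsion R (ModuleCat.of R F) ↔ ∀ N : ModuleCat.{u} R, IsCFlat R C N → extZero R N M := by
  have key (G : Type u) [AddCommGroup G] [Module R G] [Module.Flat R G] :
      HigherExtVanishes R (G ⊗[R] C) M ↔ HigherExtVanishes R G F := by
    rw [HigherExtVanishes.congr (LinearEquiv.refl R (G ⊗[R] C)) e,
      HigherExtVanishes.congr (LinearEquiv.refl R G) (hC.homTensorEquiv F)]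
    exact forall_congr' ((hC.higherExtVanishes_tensor F).subsingleton_ext_tensor_iff G)
  constructor
  · rintro h N ⟨G, hG, ⟨e'⟩⟩
    rw [extZero_iff, HigherExtVanishes.congr e' (LinearEquiv.refl R M), key]
    exact (extZero_iff _ _).1 (h G hG)
  · intro h G hG
    rw [extZero_iff, ← key]
    exact (extZero_iff (ModuleCat.of R (G ⊗[R] C)) M).1 (h _ ⟨G, hG, ⟨LinearEquiv.refl R _⟩⟩)

end Semidualizing

lemma IsCotorsion.of_equiv {M N : ModuleCat.{u} R} (h : IsCotorsion R M) (e : M ≃ₗ[R] N) :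
    IsCotorsion R N := fun F hF =>
  (extZero_iff F N).2 <|
    (HigherExtVanishes.congr (LinearEquiv.refl R F) e).1 ((extZero_iff F M).1 (h F hF))

end

/-- Characterizations of `C`-flat `C`-cotorsion modules, and
`Ext_R^{≥1}(N, W) = 0` for `N` `C`-flat and `W` `C`-flat `C`-cotorsion. -/
theorem stmt13 (R : Type u) [CommRing R] [IsNoetherianRing R]
    (C : ModuleCat.{u} R) (hC : IsSemidualizing R C) :
    (∀ M : ModuleCat.{u} R,
      (IsCFlatCotorsion R C M ↔
        (IsCFlat R C M ∧ ∀ N : ModuleCat.{u} R, IsCFlat R C N → extZero R N M)) ∧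
      (IsCFlatCotorsion R C M ↔
        (Module.Flat R (↥C →ₗ[R] ↥M) ∧
         IsCotorsion R (ModuleCat.of R (↥C →ₗ[R] ↥M)) ∧
         InBassClass R C M))) ∧
    (∀ N W : ModuleCat.{u} R, IsCFlat R C N → IsCFlatCotorsion R C W →
      extZero R N W) := by
  have key (M : ModuleCat.{u} R) : IsCFlatCotorsion R C M ↔
      (IsCFlat R C M ∧ ∀ N : ModuleCat.{u} R, IsCFlat R C N → extZero R N M) := by
    constructor
    · rintro ⟨F, hF, hF', ⟨e⟩⟩
      exact ⟨⟨F, hF, ⟨e⟩⟩, (hC.isCotorsion_iff F e).1 hF'⟩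
    · rintro ⟨⟨F, hF, ⟨e⟩⟩, h⟩
      exact ⟨F, hF, (hC.isCotorsion_iff F e).2 h, ⟨e⟩⟩
  refine ⟨fun M => ⟨key M, ?_, ?_⟩, fun N W hN hW => ((key W).1 hW).2 N hN⟩
  · rintro ⟨F, hF, hF', ⟨e⟩⟩
    let e' : F ≃ₗ[R] (C →ₗ[R] M) := hC.homTensorEquiv F ≪≫ₗ e.symm.congrRight
    exact ⟨Module.Flat.of_linearEquiv e'.symm, hF'.of_equiv e', hC.inBassClass_of_equiv F e⟩
  · rintro ⟨hF, hF', -, -, hb⟩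
    exact ⟨ModuleCat.of R (C →ₗ[R] M), hF, hF',
      ⟨(LinearEquiv.ofBijective _ hb).symm ≪≫ₗ TensorProduct.comm R _ _⟩⟩
end

section
/- Let R be a commutative noetherian ring and C a semidualizing R-module. The class of C-flat C-cotorsion R-modules is closed under arbitrary direct products, extensions, and direct summands: a product of C-flat C-cotorsion modules is C-flat C-cotorsion; in a short exact sequence 0 → M' → M → M'' → 0, if M' and M'' are C-flat C-cotorsion then so is M; and a direct summand of a C-flat C-cotorsion module is C-flat C-cotorsion. -/
open CategoryTheory TensorProduct

universe u

theorem extZero_iff_of_projectiveResolution {R : Type u} [CommRing R] {M : ModuleCat.{u} R}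
    (P : ProjectiveResolution M) (N : ModuleCat.{u} R) :
    extZero R M N ↔ ∀ (i : ℕ) (φ : P.complex.X (i + 1) ⟶ N), P.complex.d (i + 2) (i + 1) ≫ φ = 0 →
      ∃ ψ : P.complex.X i ⟶ N, P.complex.d (i + 1) i ≫ ψ = φ := by
  have step (i : ℕ) :
      Subsingleton (((Ext R (ModuleCat.{u} R) (i + 1)).obj (Opposite.op M)).obj N) ↔
        ∀ φ : P.complex.X (i + 1) ⟶ N, P.complex.d (i + 2) (i + 1) ≫ φ = 0 →
          ∃ ψ : P.complex.X i ⟶ N, P.complex.d (i + 1) i ≫ ψ = φ := by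
    rw [← ModuleCat.isZero_iff_subsingleton, (P.isoExt (R := R) (i + 1) N).isZero_iff,
      ← HomologicalComplex.exactAt_iff_isZero_homology,
      HomologicalComplex.exactAt_iff' _ i (i + 1) (i + 2) (by simp) (by simp),
      ShortComplex.moduleCat_exact_iff]
    rfl
  refine ⟨fun h i ↦ (step i).1 (h (i + 1) i.succ_pos), fun h i hi ↦ ?_⟩
  obtain ⟨j, rfl⟩ := Nat.exists_eq_add_of_le' hi
  exact (step j).2 (h j)

theorem extZero_pi {R : Type u} [CommRing R] {M : ModuleCat.{u} R} {ι : Type u}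
    (N : ι → ModuleCat.{u} R) (h : ∀ l, extZero R M (N l)) :
    extZero R M (ModuleCat.of R (∀ l, N l)) := by
  let P := projectiveResolution M
  rw [extZero_iff_of_projectiveResolution P]
  intro i φ hφ
  let p (l : ι) : ModuleCat.of R (∀ l, N l) ⟶ N l := ModuleCat.ofHom (LinearMap.proj l)
  choose ψ hψ using fun l ↦ (extZero_iff_of_projectiveResolution P (N l)).1 (h l) i (φ ≫ p l)
    (by rw [← Category.assoc, hφ, Limits.zero_comp])
  refine ⟨ModuleCat.ofHom (LinearMap.pi fun l ↦ (ψ l).hom), ?_⟩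
  ext x l
  exact congrArg (fun t ↦ t.hom x) (hψ l)

theorem extZero_of_retract {R : Type u} [CommRing R] {M N N' : ModuleCat.{u} R} (j : N ⟶ N')
    (r : N' ⟶ N) (hjr : j ≫ r = 𝟙 N) (h : extZero R M N') : extZero R M N := by
  let P := projectiveResolution M
  rw [extZero_iff_of_projectiveResolution P] at h ⊢
  intro i φ hφ
  obtain ⟨ψ, hψ⟩ := h i (φ ≫ j) (by rw [← Category.assoc, hφ, Limits.zero_comp])
  exact ⟨ψ ≫ r, by rw [← Category.assoc, hψ, Category.assoc, hjr, Category.comp_id]⟩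

theorem extZero_of_shortExact {R : Type u} [CommRing R] {M : ModuleCat.{u} R}
    {S : ShortComplex (ModuleCat.{u} R)} (hS : S.ShortExact) (h₁ : extZero R M S.X₁)
    (h₃ : extZero R M S.X₃) : extZero R M S.X₂ := by
  have := hS.mono_f
  have := hS.epi_g
  let P := projectiveResolution M
  rw [extZero_iff_of_projectiveResolution P] at h₁ h₃ ⊢
  intro i φ hφ
  obtain ⟨ψ, hψ⟩ := h₃ i (φ ≫ S.g) (by rw [← Category.assoc, hφ, Limits.zero_comp])
  let ψ' := Projective.factorThru ψ S.g
  have hψ' : ψ' ≫ S.g = ψ := Projective.factorThru_comp _ _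
  have hχ : (φ - P.complex.d (i + 1) i ≫ ψ') ≫ S.g = 0 := by simp [hψ', hψ]
  obtain ⟨ξ, hξ⟩ := h₁ i (hS.exact.lift _ hχ) (by simp [← cancel_mono S.f, hφ])
  refine ⟨ψ' + ξ ≫ S.f, ?_⟩
  rw [Preadditive.comp_add, ← Category.assoc, hξ, hS.exact.lift_f]
  abel

theorem exists_extension_of_extZero {R : Type u} [CommRing R] {N : ModuleCat.{u} R}
    {S : ShortComplex (ModuleCat.{u} R)} (hS : S.ShortExact) [Projective S.X₂]
    (h : extZero R S.X₃ N) (φ : S.X₁ ⟶ N) : ∃ ψ : S.X₂ ⟶ N, S.f ≫ ψ = φ := by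
  have := hS.mono_f
  have := hS.epi_g
  let P := projectiveResolution S.X₃
  rw [extZero_iff_of_projectiveResolution P] at h
  let π : P.complex.X 0 ⟶ S.X₃ := P.π.f 0
  have : Epi π := inferInstanceAs (Epi (P.π.f 0))
  have hdπ : P.complex.d 1 0 ≫ π = 0 := P.complex_d_comp_π_f_zero
  let a : P.complex.X 0 ⟶ S.X₂ := Projective.factorThru π S.g
  have ha : a ≫ S.g = π := Projective.factorThru_comp _ _
  let s : S.X₂ ⟶ P.complex.X 0 := Projective.factorThru S.g π
  have hs : s ≫ π = S.g := Projective.factorThru_comp _ _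
  have hb' : (P.complex.d 1 0 ≫ a) ≫ S.g = 0 := by rw [Category.assoc, ha, hdπ]
  let b : P.complex.X 1 ⟶ S.X₁ := hS.exact.lift _ hb'
  have hb : b ≫ S.f = P.complex.d 1 0 ≫ a := hS.exact.lift_f _ _
  have ht' : (s ≫ a - 𝟙 _) ≫ S.g = 0 := by
    rw [Preadditive.sub_comp, Category.assoc, ha, hs, Category.id_comp, sub_self]
  let t : S.X₂ ⟶ S.X₁ := hS.exact.lift _ ht'
  have ht : t ≫ S.f = s ≫ a - 𝟙 _ := hS.exact.lift_f _ _
  obtain ⟨ξ, hξ⟩ := h 0 (b ≫ φ) (by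
    rw [← Category.assoc, ← Limits.zero_comp (X := P.complex.X 2) (f := φ)]
    congr 1
    simp [← cancel_mono S.f, hb])
  refine ⟨s ≫ ξ - t ≫ φ, ?_⟩
  ext k
  obtain ⟨q, hq⟩ := (ShortComplex.moduleCat_exact_iff _).1 P.exact₀ ((S.f ≫ s).hom k) (by
    change (((S.f ≫ s) ≫ π).hom) k = 0
    rw [Category.assoc, hs, S.zero]
    rfl)
  have hq' : (P.complex.d 1 0).hom q = s.hom (S.f.hom k) := hq
  have hbq : b.hom q = k + t.hom (S.f.hom k) := by
    apply (ModuleCat.mono_iff_injective S.f).1 inferInstance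
    have h₁ := congrArg (fun u ↦ u.hom q) hb
    have h₂ := congrArg (fun u ↦ u.hom (S.f.hom k)) ht
    simp only [ModuleCat.hom_comp, ModuleCat.hom_sub, LinearMap.comp_apply, LinearMap.sub_apply,
      ModuleCat.hom_id, LinearMap.id_apply] at h₁ h₂
    rw [hq'] at h₁
    rw [map_add]
    refine h₁.trans ?_
    rw [h₂]
    abel
  have hξq := congrArg (fun u ↦ u.hom q) hξ
  simp only [ModuleCat.hom_comp, LinearMap.comp_apply] at hξq
  simp only [ModuleCat.hom_comp, ModuleCat.hom_sub, LinearMap.comp_apply, LinearMap.sub_apply]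
  rw [← hq']
  refine (congrArg (· - _) hξq).trans ?_
  rw [hbq, map_add, add_sub_cancel_right]

theorem piRightHom_bijective_of_finitePresentation {R : Type*} [CommRing R] {ι : Type*} (N : Type*)
    [AddCommGroup N] [Module R N] [Module.FinitePresentation R N] (F : ι → Type*)
    [∀ l, AddCommGroup (F l)] [∀ l, Module R (F l)] :
    Function.Bijective (TensorProduct.piRightHom R R N F) := by
  have free (n : ℕ) : Function.Bijective (TensorProduct.piRightHom R R (Fin n → R) F) := by
    let e' (l : ι) : (Fin n → R) ⊗[R] F l ≃ₗ[R] (Fin n → F l) :=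
      TensorProduct.comm R _ _ ≪≫ₗ TensorProduct.piScalarRight R R (F l) (Fin n)
    let e'' : (Fin n → R) ⊗[R] (∀ l, F l) ≃ₗ[R] (Fin n → ∀ l, F l) :=
      TensorProduct.comm R _ _ ≪≫ₗ TensorProduct.piScalarRight R R (∀ l, F l) (Fin n)
    have key (x) : TensorProduct.piRightHom R R (Fin n → R) F x =
        fun l ↦ (e' l).symm fun i ↦ e'' x i l := by
      induction x with
      | zero => ext l; simp [← Pi.zero_def]
      | add x y hx hy =>
        ext l
        rw [map_add, hx, hy, map_add, Pi.add_apply, ← map_add]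
        rfl
      | tmul a b =>
        ext l
        rw [LinearEquiv.eq_symm_apply]
        ext i
        simp [e', e'']
    constructor
    · rw [injective_iff_map_eq_zero]
      intro x hx
      rw [key] at hx
      apply e''.injective
      ext i l
      have := congrFun hx l
      simp only [Pi.zero_apply, LinearEquiv.map_eq_zero_iff] at this
      simpa using congrFun this i
    · intro y
      refine ⟨e''.symm fun i l ↦ e' l (y l) i, ?_⟩
      rw [key]
      ext l
      simp
  obtain ⟨n, m, f, g, hf, hgf⟩ := Module.FinitePresentation.exists_fin' R N
  refine LinearMap.bijective_of_surjective_of_bijective_of_right_exact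
    (g.rTensor (∀ l, F l)) (f.rTensor (∀ l, F l))
    (LinearMap.pi fun l ↦ (g.rTensor (F l)).comp (LinearMap.proj l))
    (LinearMap.pi fun l ↦ (f.rTensor (F l)).comp (LinearMap.proj l))
    (TensorProduct.piRightHom R R (Fin m → R) F) (TensorProduct.piRightHom R R (Fin n → R) F) _
    ?_ ?_ (rTensor_exact _ hgf hf) ?_ (free m).2 (free n) (LinearMap.rTensor_surjective _ hf) ?_
  · ext; simp
  · ext; simp
  · intro y
    have h (l : ι) := rTensor_exact (F l) hgf hf (y l)
    constructor
    · intro hy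
      choose x hx using fun l ↦ (h l).1 (congrFun hy l)
      exact ⟨x, funext hx⟩
    · rintro ⟨x, rfl⟩
      ext l
      exact (h l).2 ⟨x l, rfl⟩
  · intro y
    choose x hx using fun l ↦ LinearMap.rTensor_surjective (F l) hf (y l)
    exact ⟨x, funext hx⟩

theorem flat_pi {R : Type u} [CommRing R] [IsNoetherianRing R] {ι : Type*} (F : ι → Type*)
    [∀ l, AddCommGroup (F l)] [∀ l, Module R (F l)] [∀ l, Module.Flat R (F l)] :
    Module.Flat R (∀ l, F l) := by
  rw [Module.Flat.iff_rTensor_injective]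
  intro I hI
  have : Module.Finite R I := Module.Finite.iff_fg.2 hI
  have : Module.FinitePresentation R I := Module.finitePresentation_of_finite R I
  have key (x) : TensorProduct.piRightHom R R R F (I.subtype.rTensor (∀ l, F l) x) =
      fun l ↦ I.subtype.rTensor (F l) (TensorProduct.piRightHom R R I F x l) := by
    induction x with
    | zero => ext; simp
    | add x y hx hy => rw [map_add, map_add, hx, hy]; ext; simp
    | tmul a b => rfl
  intro x y hxy
  apply (piRightHom_bijective_of_finitePresentation (R := R) I F).1
  have h := congrArg (TensorProduct.piRightHom R R R F) hxy
  rw [key, key] at h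
  ext l
  exact Module.Flat.rTensor_preserves_injective_linearMap _ I.subtype_injective (congrFun h l)

theorem flat_of_exact {R : Type*} [CommRing R] {A B D : Type*} [AddCommGroup A] [AddCommGroup B]
    [AddCommGroup D] [Module R A] [Module R B] [Module R D] [Module.Flat R A] [Module.Flat R D]
    {f : A →ₗ[R] B} {g : B →ₗ[R] D} (hf : Function.Injective f) (hg : Function.Surjective g)
    (hfg : Function.Exact f g) : Module.Flat R B := by
  rw [Module.Flat.iff_rTensor_injective]
  intro I _
  rw [injective_iff_map_eq_zero]
  intro x hx
  have hgx : g.lTensor I x = 0 := by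
    apply Module.Flat.rTensor_preserves_injective_linearMap (M := D) _ I.subtype_injective
    rw [← LinearMap.comp_apply, LinearMap.rTensor_comp_lTensor, ← LinearMap.lTensor_comp_rTensor,
      LinearMap.comp_apply, hx, map_zero, map_zero]
  obtain ⟨y, rfl⟩ := (lTensor_exact I hfg hg x).1 hgx
  suffices y = 0 by rw [this, map_zero]
  apply Module.Flat.rTensor_preserves_injective_linearMap (M := A) _ I.subtype_injective
  apply LinearMap.lTensor_injective_of_exact_of_flat g hg f hf hfg R
  rw [map_zero, map_zero, ← hx, ← LinearMap.comp_apply, LinearMap.lTensor_comp_rTensor,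
    ← LinearMap.rTensor_comp_lTensor, LinearMap.comp_apply]

theorem lTensorHomToHomLTensor_bijective_s15 {R : Type*} [CommRing R] (K F C : Type*) [AddCommGroup K]
    [AddCommGroup F] [AddCommGroup C] [Module R K] [Module R F] [Module R C]
    [Module.FinitePresentation R K] [Module.Flat R F] :
    Function.Bijective (lTensorHomToHomLTensor (.id R) K F C) := by
  obtain ⟨n, m, f, g, hf, hgf⟩ := Module.FinitePresentation.exists_fin' R K
  have free (n : ℕ) : Function.Bijective (lTensorHomToHomLTensor (.id R) (Fin n → R) F C) := by
    rw [← lTensorHomEquivHomLTensor_toLinearMap]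
    exact LinearEquiv.bijective _
  refine LinearMap.bijective_of_bijective_of_injective_of_left_exact
    ((LinearMap.lcomp R C f).lTensor F) ((LinearMap.lcomp R C g).lTensor F)
    (LinearMap.lcomp R (F ⊗[R] C) f) (LinearMap.lcomp R (F ⊗[R] C) g) _
    (lTensorHomToHomLTensor (.id R) (Fin n → R) F C)
    (lTensorHomToHomLTensor (.id R) (Fin m → R) F C) ?_ ?_
    (Module.Flat.lTensor_exact F (LinearMap.exact_lcomp_of_exact_of_surjective C hgf hf))
    (LinearMap.exact_lcomp_of_exact_of_surjective _ hgf hf)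
    (free n) (free m).1 (Module.Flat.lTensor_preserves_injective_linearMap _
      (LinearMap.lcomp_injective_of_surjective f hf)) (LinearMap.lcomp_injective_of_surjective f hf)
  · refine TensorProduct.ext' fun x φ ↦ LinearMap.ext fun k ↦ ?_
    simp
  · refine TensorProduct.ext' fun x φ ↦ LinearMap.ext fun k ↦ ?_
    simp

theorem mk_bijective_of_isSemidualizing {R : Type u} [CommRing R] [IsNoetherianRing R]
    {C : ModuleCat.{u} R} (hC : IsSemidualizing R C) (F : Type*) [AddCommGroup F] [Module R F]
    [Module.Flat R F] : Function.Bijective (TensorProduct.mk R F C) := by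
  have := hC.1
  have : Module.FinitePresentation R C := Module.finitePresentation_of_finite R C
  let e : F ≃ₗ[R] F ⊗[R] (C →ₗ[R] C) :=
    (TensorProduct.rid R F).symm ≪≫ₗ
      LinearEquiv.lTensor F (LinearEquiv.ofBijective (LinearMap.lsmul R C) hC.2.1)
  have h : TensorProduct.mk R F C = lTensorHomToHomLTensor (.id R) C F C ∘ₗ e.toLinearMap := by
    ext x c
    simp [e]
  rw [h, LinearMap.coe_comp]
  exact (lTensorHomToHomLTensor_bijective_s15 C F C).comp e.bijective

theorem exists_comp_eq_of_comp_eq_zero {R : Type*} [CommRing R] {A B D K : Type*}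
    [AddCommGroup A] [AddCommGroup B] [AddCommGroup D] [AddCommGroup K] [Module R A] [Module R B]
    [Module R D] [Module R K] {f : A →ₗ[R] B} {g : B →ₗ[R] D} (hf : Function.Injective f)
    (hfg : Function.Exact f g) (γ : K →ₗ[R] B) (hγ : g ∘ₗ γ = 0) : ∃ φ : K →ₗ[R] A, f ∘ₗ φ = γ := by
  have h (k : K) : γ k ∈ LinearMap.range f := (hfg _).1 (congrArg (fun u ↦ u k) hγ)
  refine ⟨(LinearEquiv.ofInjective f hf).symm.toLinearMap ∘ₗ γ.codRestrict _ h, ?_⟩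
  ext k
  exact congrArg Subtype.val ((LinearEquiv.ofInjective f hf).apply_symm_apply ⟨γ k, h k⟩)

theorem exists_lift_of_isSemidualizing {R : Type u} [CommRing R] [IsNoetherianRing R]
    {C : ModuleCat.{u} R} (hC : IsSemidualizing R C) {F E Y : Type*} [AddCommGroup F] [Module R F]
    [Module.Flat R F] [AddCommGroup E] [Module R E] [AddCommGroup Y] [Module R Y]
    {f : F ⊗[R] C →ₗ[R] E} {g : E →ₗ[R] Y} (hf : Function.Injective f)
    (hg : Function.Surjective g) (hfg : Function.Exact f g) (α : C →ₗ[R] Y) :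
    ∃ β : C →ₗ[R] E, g ∘ₗ β = α := by
  have := hC.1
  obtain ⟨n, p, hp⟩ := Module.Finite.exists_fin' R C
  let K := LinearMap.ker p
  have : Module.FinitePresentation R K := Module.finitePresentation_of_finite R K
  have hK : Function.Surjective (LinearMap.lcomp R C K.subtype) := by
    intro φ
    have : Projective (ModuleCat.of R (Fin n → R)) := inferInstance
    obtain ⟨ψ, hψ⟩ := exists_extension_of_extZero (LinearMap.shortExact_shortComplexKer hp) hC.2.2
      (ModuleCat.ofHom φ)
    exact ⟨ψ.hom, congrArg ModuleCat.Hom.hom hψ⟩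
  have hKF : Function.Surjective (LinearMap.lcomp R (F ⊗[R] C) K.subtype) := by
    have h : LinearMap.lcomp R (F ⊗[R] C) K.subtype ∘ₗ
          lTensorHomToHomLTensor (.id R) (Fin n → R) F C =
        lTensorHomToHomLTensor (.id R) K F C ∘ₗ (LinearMap.lcomp R C K.subtype).lTensor F := by
      refine TensorProduct.ext' fun x φ ↦ LinearMap.ext fun k ↦ ?_
      simp
    apply Function.Surjective.of_comp (g := lTensorHomToHomLTensor (.id R) (Fin n → R) F C)
    rw [← LinearMap.coe_comp, h, LinearMap.coe_comp]
    exact (lTensorHomToHomLTensor_bijective_s15 K F C).2.comp (LinearMap.lTensor_surjective F hK)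
  obtain ⟨γ, hγ⟩ := Module.projective_lifting_property g (α ∘ₗ p) hg
  obtain ⟨φ, hφ⟩ := exists_comp_eq_of_comp_eq_zero hf hfg (γ ∘ₗ K.subtype) (by
    rw [← LinearMap.comp_assoc, hγ, LinearMap.comp_assoc,
      p.exact_subtype_ker_map.linearMap_comp_eq_zero, LinearMap.comp_zero])
  obtain ⟨ψ, hψ⟩ := hKF φ
  obtain ⟨β, hβ⟩ := (LinearMap.exact_lcomp_of_exact_of_surjective E p.exact_subtype_ker_map hp
    (γ - f ∘ₗ ψ)).1 (by
      ext k
      have : ψ k = φ k := congrArg (fun u ↦ u k) hψ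
      simpa [this, sub_eq_zero] using (congrArg (fun u ↦ u k) hφ).symm)
  refine ⟨β, ?_⟩
  rw [← LinearMap.cancel_right hp, LinearMap.comp_assoc]
  refine (congrArg (g ∘ₗ ·) hβ).trans ?_
  rw [LinearMap.comp_sub, hγ, ← LinearMap.comp_assoc, hfg.linearMap_comp_eq_zero,
    LinearMap.zero_comp, sub_zero]

theorem IsCotorsion.of_retract {R : Type u} [CommRing R] {N N' : ModuleCat.{u} R}
    (h : IsCotorsion R N') (j : N →ₗ[R] N') (r : N' →ₗ[R] N) (hrj : r ∘ₗ j = LinearMap.id) :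
    IsCotorsion R N := fun F hF ↦
  extZero_of_retract (ModuleCat.ofHom j) (ModuleCat.ofHom r) (ModuleCat.hom_ext hrj) (h F hF)

theorem isCFlatCotorsion_of_bijective_lift {R : Type u} [CommRing R] {C M : ModuleCat.{u} R}
    (hflat : Module.Flat R (C →ₗ[R] M)) (hcot : IsCotorsion R (ModuleCat.of R (C →ₗ[R] M)))
    (hev : Function.Bijective (TensorProduct.lift (LinearMap.id (R := R) (M := C →ₗ[R] M)))) :
    IsCFlatCotorsion R C M :=
  ⟨_, hflat, hcot, ⟨(LinearEquiv.ofBijective _ hev).symm⟩⟩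

theorem isCFlatCotorsion_pi {R : Type u} [CommRing R] [IsNoetherianRing R] {C : ModuleCat.{u} R}
    [Module.Finite R C] {ι : Type u} (M : ι → ModuleCat.{u} R)
    (hM : ∀ l, IsCFlatCotorsion R C (M l)) :
    IsCFlatCotorsion R C (ModuleCat.of R (∀ l, M l)) := by
  have : Module.FinitePresentation R C := Module.finitePresentation_of_finite R C
  choose F hflat hcot e using hM
  refine ⟨ModuleCat.of R (∀ l, F l), flat_pi _,
    fun G hG ↦ extZero_pi F fun l ↦ hcot l G hG, ⟨?_⟩⟩
  exact LinearEquiv.piCongrRight (fun l ↦ (e l).some ≪≫ₗ TensorProduct.comm R _ _) ≪≫ₗ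
    (LinearEquiv.ofBijective _
      (piRightHom_bijective_of_finitePresentation (R := R) C fun l ↦ F l)).symm ≪≫ₗ
    TensorProduct.comm R _ _

theorem IsCotorsion.of_exact {R : Type u} [CommRing R] {A B D : ModuleCat.{u} R}
    (hA : IsCotorsion R A) (hD : IsCotorsion R D) {f : A →ₗ[R] B} {g : B →ₗ[R] D}
    (hf : Function.Injective f) (hg : Function.Surjective g) (hfg : Function.Exact f g) :
    IsCotorsion R B := fun F hF ↦
  extZero_of_shortExact (ModuleCat.shortComplex_shortExact
    (ShortComplex.mk (ModuleCat.ofHom f) (ModuleCat.ofHom g)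
      (ModuleCat.hom_ext hfg.linearMap_comp_eq_zero)) hfg hf hg) (hA F hF) (hD F hF)

theorem bijective_of_rTensor_exact {R : Type*} [CommRing R] {A B D C M : Type*} [AddCommGroup A]
    [AddCommGroup B] [AddCommGroup D] [AddCommGroup C] [AddCommGroup M] [Module R A] [Module R B]
    [Module R D] [Module R C] [Module R M] {u : A →ₗ[R] B} {v : B →ₗ[R] D}
    (hv : Function.Surjective v) (huv : Function.Exact u v) {i : A ⊗[R] C →ₗ[R] M}
    {q : M →ₗ[R] D ⊗[R] C} (hi : Function.Injective i) (hiq : Function.Exact i q)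
    {e : B ⊗[R] C →ₗ[R] M} (hei : e ∘ₗ u.rTensor C = i) (hqe : q ∘ₗ e = v.rTensor C) :
    Function.Bijective e := by
  have hei' (y) : e (u.rTensor C y) = i y := congrArg (fun t ↦ t y) hei
  have hqe' (y) : q (e y) = v.rTensor C y := congrArg (fun t ↦ t y) hqe
  refine ⟨(injective_iff_map_eq_zero e).2 fun x hx ↦ ?_, fun m ↦ ?_⟩
  · obtain ⟨y, rfl⟩ := (rTensor_exact C huv hv x).1 (by rw [← hqe', hx, map_zero])
    rw [hei'] at hx
    rw [(injective_iff_map_eq_zero i).1 hi y hx, map_zero]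
  · obtain ⟨x, hx⟩ := LinearMap.rTensor_surjective C hv (q m)
    obtain ⟨y, hy⟩ := (hiq (m - e x)).1 (by rw [map_sub, hqe', hx, sub_self])
    exact ⟨u.rTensor C y + x, by rw [map_add, hei', hy, sub_add_cancel]⟩

theorem isCFlatCotorsion_of_exact {R : Type u} [CommRing R] [IsNoetherianRing R]
    {C : ModuleCat.{u} R} (hC : IsSemidualizing R C) {M' M M'' : ModuleCat.{u} R}
    {f : M' →ₗ[R] M} {g : M →ₗ[R] M''} (hf : Function.Injective f) (hg : Function.Surjective g)
    (hfg : Function.Exact f g) (hM' : IsCFlatCotorsion R C M') (hM'' : IsCFlatCotorsion R C M'') :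
    IsCFlatCotorsion R C M := by
  obtain ⟨F', hF', hcot', ⟨e'⟩⟩ := hM'
  obtain ⟨F'', hF'', hcot'', ⟨e''⟩⟩ := hM''
  let i : F' ⊗[R] C →ₗ[R] M := f ∘ₗ e'.symm.toLinearMap
  let q : M →ₗ[R] F'' ⊗[R] C := e''.toLinearMap ∘ₗ g
  have hi : Function.Injective i := hf.comp e'.symm.injective
  have hq : Function.Surjective q := e''.surjective.comp hg
  have hiq : Function.Exact i q := by
    intro x
    rw [LinearMap.comp_apply, LinearEquiv.coe_coe, LinearEquiv.map_eq_zero_iff, hfg x,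
      LinearMap.coe_comp, LinearEquiv.coe_coe, e'.symm.surjective.range_comp]
  have hη' := mk_bijective_of_isSemidualizing hC F'
  let η'' := LinearEquiv.ofBijective _ (mk_bijective_of_isSemidualizing hC F'')
  let u : F' →ₗ[R] C →ₗ[R] M := LinearMap.compRight R i ∘ₗ TensorProduct.mk R F' C
  let v : (C →ₗ[R] M) →ₗ[R] F'' := η''.symm.toLinearMap ∘ₗ LinearMap.compRight R q
  have hηv (φ : C →ₗ[R] M) : TensorProduct.mk R F'' C (v φ) = q ∘ₗ φ := η''.apply_symm_apply _
  have hu : Function.Injective u := fun x y hxy ↦ hη'.1 ((LinearMap.cancel_left hi).1 hxy)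
  have hv : Function.Surjective v :=
    η''.symm.surjective.comp fun α ↦ exists_lift_of_isSemidualizing hC hi hq hiq α
  have huv : Function.Exact u v := by
    intro φ
    have h : v φ = 0 ↔ q ∘ₗ φ = 0 := η''.symm.map_eq_zero_iff
    rw [h]
    constructor
    · intro hφ
      obtain ⟨χ, rfl⟩ := exists_comp_eq_of_comp_eq_zero hi hiq φ hφ
      obtain ⟨x, rfl⟩ := hη'.2 χ
      exact ⟨x, rfl⟩
    · rintro ⟨x, rfl⟩
      change q ∘ₗ i ∘ₗ TensorProduct.mk R F' C x = 0
      rw [← LinearMap.comp_assoc, hiq.linearMap_comp_eq_zero, LinearMap.zero_comp]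
  have hei : TensorProduct.lift LinearMap.id ∘ₗ u.rTensor C = i :=
    TensorProduct.ext' fun x c ↦ rfl
  have hqe : q ∘ₗ TensorProduct.lift LinearMap.id = v.rTensor C :=
    TensorProduct.ext' fun φ c ↦ (congrArg (fun t ↦ t c) (hηv φ)).symm
  exact isCFlatCotorsion_of_bijective_lift (flat_of_exact hu hv huv)
    (hcot'.of_exact hcot'' (B := ModuleCat.of R (C →ₗ[R] M)) hu hv huv)
    (bijective_of_rTensor_exact hv huv hi hiq hei hqe)

theorem IsCFlatCotorsion.of_retract {R : Type u} [CommRing R] [IsNoetherianRing R]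
    {C : ModuleCat.{u} R} (hC : IsSemidualizing R C) {M N : ModuleCat.{u} R}
    (hM : IsCFlatCotorsion R C M) (j : N →ₗ[R] M) (r : M →ₗ[R] N) (hrj : r ∘ₗ j = LinearMap.id) :
    IsCFlatCotorsion R C N := by
  obtain ⟨F, hF, hcot, ⟨e⟩⟩ := hM
  let η := LinearEquiv.ofBijective _ (mk_bijective_of_isSemidualizing hC F)
  let j' : N →ₗ[R] F ⊗[R] C := e.toLinearMap ∘ₗ j
  let r' : F ⊗[R] C →ₗ[R] N := r ∘ₗ e.symm.toLinearMap
  have hrj' (n : N) : r' (j' n) = n := by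
    simpa [r', j'] using congrArg (fun t ↦ t n) hrj
  let J : (C →ₗ[R] N) →ₗ[R] F := η.symm.toLinearMap ∘ₗ LinearMap.compRight R j'
  let P : F →ₗ[R] (C →ₗ[R] N) := LinearMap.compRight R r' ∘ₗ η.toLinearMap
  have hηJ (φ : C →ₗ[R] N) : TensorProduct.mk R F C (J φ) = j' ∘ₗ φ := η.apply_symm_apply _
  have hPJ : P ∘ₗ J = LinearMap.id := by
    ext φ c
    change r' (TensorProduct.mk R F C (J φ) c) = φ c
    rw [hηJ]
    exact hrj' _
  have hPJ' (x) : P.rTensor C (J.rTensor C x) = x := by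
    rw [← LinearMap.comp_apply, ← LinearMap.rTensor_comp, hPJ, LinearMap.rTensor_id,
      LinearMap.id_apply]
  have hcomm₁ : j' ∘ₗ TensorProduct.lift LinearMap.id = J.rTensor C :=
    TensorProduct.ext' fun φ c ↦ (congrArg (fun t ↦ t c) (hηJ φ)).symm
  have hcomm₂ : TensorProduct.lift LinearMap.id ∘ₗ P.rTensor C = r' :=
    TensorProduct.ext' fun x c ↦ rfl
  refine isCFlatCotorsion_of_bijective_lift (Module.Flat.of_retract J P hPJ)
    (hcot.of_retract J P hPJ) ⟨?_, fun n ↦ ⟨P.rTensor C (j' n), ?_⟩⟩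
  · rw [injective_iff_map_eq_zero]
    intro x hx
    rw [← hPJ' x, ← hcomm₁, LinearMap.comp_apply, hx, map_zero, map_zero]
  · rw [← LinearMap.comp_apply, hcomm₂, hrj']

/-- The class of `C`-flat `C`-cotorsion modules is closed under
arbitrary products, extensions, and direct summands. -/
theorem stmt15 (R : Type u) [CommRing R] [IsNoetherianRing R]
    (C : ModuleCat.{u} R) (hC : IsSemidualizing R C) :
    (∀ (ι : Type u) (M : ι → ModuleCat.{u} R),
        (∀ l : ι, IsCFlatCotorsion R C (M l)) →
        IsCFlatCotorsion R C (ModuleCat.of R (∀ l : ι, ↥(M l)))) ∧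
    (∀ (M' M M'' : ModuleCat.{u} R) (f : ↥M' →ₗ[R] ↥M) (g : ↥M →ₗ[R] ↥M''),
        Function.Injective f → Function.Surjective g → Function.Exact f g →
        IsCFlatCotorsion R C M' → IsCFlatCotorsion R C M'' →
        IsCFlatCotorsion R C M) ∧
    (∀ (M N : ModuleCat.{u} R), IsCFlatCotorsion R C M →
        (∃ (ι : ↥N →ₗ[R] ↥M) (π : ↥M →ₗ[R] ↥N), π.comp ι = LinearMap.id) →
        IsCFlatCotorsion R C N) := by
  have := hC.1
  exact ⟨fun _ ↦ isCFlatCotorsion_pi, fun _ _ _ _ _ ↦ isCFlatCotorsion_of_exact hC,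
    fun _ _ hM ⟨j, r, hrj⟩ ↦ hM.of_retract hC j r hrj⟩
end

section
/- Let R be a commutative noetherian ring and C a semidualizing R-module. If M is a C-flat R-module, then there exists a short exact sequence 0 → M → M_1 → M_2 → 0 of R-modules in which M_1 is C-flat C-cotorsion and M_2 is C-flat. -/
open CategoryTheory TensorProduct

universe u

section FlatSequences
variable {R : Type*} [CommRing R]
variable {M N P : Type*} [AddCommGroup M] [AddCommGroup N] [AddCommGroup P]
  [Module R M] [Module R N] [Module R P]

/-- A short exact sequence with flat cokernel stays injective after tensoring. -/
lemma rTensor_injective_of_exact_of_flat [Module.Flat R P]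
    {f : M →ₗ[R] N} {g : N →ₗ[R] P} (hf : Function.Injective f) (hg : Function.Surjective g)
    (H : Function.Exact f g) (A : Type*) [AddCommGroup A] [Module R A] :
    Function.Injective (f.rTensor A) := by
  have h := LinearMap.lTensor_injective_of_exact_of_flat g hg f hf H A
  rw [← LinearMap.comm_comp_rTensor_comp_comm_eq] at h
  simpa using h

/-- The kernel of a surjection between flat modules is flat. -/
lemma flat_of_exact_of_flat_of_flat [Module.Flat R N] [Module.Flat R P]
    {f : M →ₗ[R] N} {g : N →ₗ[R] P} (hf : Function.Injective f) (hg : Function.Surjective g)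
    (H : Function.Exact f g) : Module.Flat R M := by
  rw [Module.Flat.iff_rTensor_injective']
  intro I
  have h₁ := LinearMap.lTensor_injective_of_exact_of_flat g hg f hf H I
  have h₂ := Module.Flat.rTensor_preserves_injective_linearMap (M := N) I.subtype
    I.subtype_injective
  have h₃ : (f.lTensor R) ∘ₗ (I.subtype.rTensor M) = (I.subtype.rTensor N) ∘ₗ (f.lTensor I) := by
    rw [LinearMap.lTensor_comp_rTensor, LinearMap.rTensor_comp_lTensor]
  refine Function.Injective.of_comp (f := f.lTensor R) ?_
  rw [← LinearMap.coe_comp, h₃]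
  exact h₂.comp h₁

/-- A linear map into a character module extends along a monomorphism with flat cokernel. -/
lemma exists_extension_to_characterModule [Module.Flat R P]
    {f : M →ₗ[R] N} {g : N →ₗ[R] P} (hf : Function.Injective f) (hg : Function.Surjective g)
    (H : Function.Exact f g) {A : Type*} [AddCommGroup A] [Module R A]
    (φ : M →ₗ[R] CharacterModule A) : ∃ ψ : N →ₗ[R] CharacterModule A, ψ ∘ₗ f = φ :=
  rTensor_injective_iff_lcomp_surjective.mp (rTensor_injective_of_exact_of_flat hf hg H A) φ

end FlatSequences

section DoubleDual
variable {R : Type*} [CommRing R]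

/-- The evaluation map from a module to its double character module. -/
def characterModuleEval (R M : Type*) [CommRing R] [AddCommGroup M] [Module R M] :
    M →ₗ[R] CharacterModule (CharacterModule M) where
  toFun m := (AddMonoidHom.eval m : (M →+ AddCircle (1 : ℚ)) →+ AddCircle (1 : ℚ))
  map_add' m n := CharacterModule.ext _ fun c => map_add c m n
  map_smul' _ _ := rfl

variable {M : Type*} [AddCommGroup M] [Module R M]

lemma characterModuleEval_injective : Function.Injective (characterModuleEval R M) := by
  rw [injective_iff_map_eq_zero]
  intro m hm
  exact CharacterModule.eq_zero_of_character_apply fun c => congr($hm c)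

/-- Taking character modules preserves exactness. -/
lemma exact_dual {N P : Type*} [AddCommGroup N] [AddCommGroup P] [Module R N] [Module R P]
    {f : M →ₗ[R] N} {g : N →ₗ[R] P} (H : Function.Exact f g)
    (c : CharacterModule N) (hc : CharacterModule.dual f c = 0) :
    ∃ b : CharacterModule P, CharacterModule.dual g b = c := by
  let c' : CharacterModule (N ⧸ LinearMap.range f) :=
    QuotientAddGroup.lift (LinearMap.range f).toAddSubgroup (c : N →+ AddCircle (1 : ℚ)) (by
      rintro _ ⟨x, rfl⟩
      exact congr($hc x))
  let g' := (LinearMap.range f).liftQ g H.linearMap_ker_eq.ge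
  have hg' : Function.Injective g' := by
    rw [← LinearMap.ker_eq_bot]
    exact Submodule.ker_liftQ_eq_bot _ _ _ H.linearMap_ker_eq.le
  obtain ⟨b, hb⟩ := CharacterModule.dual_surjective_of_injective g' hg' c'
  exact ⟨b, CharacterModule.ext _ fun x => congr($hb ((LinearMap.range f).mkQ x))⟩

lemma characterModule_sum_apply {N ι : Type*} [AddCommGroup N] [Fintype ι]
    (g : ι → CharacterModule N) (y : N) : (∑ i, g i) y = ∑ i, g i y :=
  AddMonoidHom.finsetSum_apply (N := AddCircle (1 : ℚ)) g Finset.univ y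

/-- Over a noetherian ring, the character module of an injective module is flat. -/
lemma flat_characterModule_of_baer [IsNoetherianRing R] (hM : Module.Baer R M) :
    Module.Flat R (CharacterModule M) := by
  refine Module.Flat.of_forall_isTrivialRelation fun {l f x} hx => ?_
  let F : (Fin l → R) →ₗ[R] R := Fintype.linearCombination R f
  obtain ⟨k, a, ha⟩ := Submodule.fg_iff_exists_fin_generating_family.mp
    (IsNoetherian.noetherian (LinearMap.ker F))
  let D : M →ₗ[R] (Fin l → M) := LinearMap.pi fun i => f i • LinearMap.id
  let A : (Fin l → M) →ₗ[R] (Fin k → M) :=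
    LinearMap.pi fun j => ∑ i, a j i • (LinearMap.proj i : (Fin l → M) →ₗ[R] M)
  have haF : ∀ j, ∑ i, f i * a j i = 0 := fun j => by
    have h : a j ∈ LinearMap.ker F := ha ▸ Submodule.subset_span ⟨j, rfl⟩
    simpa [F, Fintype.linearCombination_apply, mul_comm] using h
  have hDA : Function.Exact D A := by
    intro t
    constructor
    · intro ht
      let T : (Fin l → R) →ₗ[R] M := Fintype.linearCombination R t
      have hT : LinearMap.ker F ≤ LinearMap.ker T := by
        rw [← ha, Submodule.span_le]
        rintro _ ⟨j, rfl⟩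
        simpa [A, T, Fintype.linearCombination_apply] using congrFun ht j
      let T' : LinearMap.range F →ₗ[R] M :=
        (LinearMap.ker F).liftQ T hT ∘ₗ F.quotKerEquivRange.symm.toLinearMap
      have hT' : ∀ v, T' ⟨F v, v, rfl⟩ = T v := fun v => by
        have : F.quotKerEquivRange.symm ⟨F v, v, rfl⟩ = (LinearMap.ker F).mkQ v := by
          rw [LinearEquiv.symm_apply_eq]
          rfl
        change (LinearMap.ker F).liftQ T hT (F.quotKerEquivRange.symm _) = _
        rw [this]
        rfl
      obtain ⟨ψ, hψ⟩ := hM (LinearMap.range F) T'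
      refine ⟨ψ 1, funext fun i => ?_⟩
      have hFi : F (Pi.single i 1) = f i := by simp [F]
      have hTi : T (Pi.single i 1) = t i := by simp [T]
      have h := (hψ (F (Pi.single i 1)) ⟨_, rfl⟩).trans (hT' _)
      rw [hFi, hTi] at h
      change f i • ψ 1 = t i
      rw [← h, ← map_smul, smul_eq_mul, mul_one]
    · rintro ⟨x, rfl⟩
      funext j
      have : (A (D x)) j = (∑ i, f i * a j i) • x := by
        simp [A, D, Finset.sum_smul, mul_comm (f _), mul_smul]
      rw [this, haF, zero_smul]
      rfl
  let c : CharacterModule (Fin l → M) :=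
    ∑ i, CharacterModule.dual (LinearMap.proj (R := R) i) (x i)
  have hcapply : ∀ t, c t = ∑ i, x i (t i) := fun t => characterModule_sum_apply _ t
  have hc : CharacterModule.dual D c = 0 := by
    ext y
    change c (D y) = 0
    rw [hcapply]
    exact (characterModule_sum_apply (fun i => f i • x i) y).symm.trans congr($hx y)
  obtain ⟨b, hb⟩ := exact_dual hDA c hc
  refine ⟨k, fun i j => a j i,
    fun j => CharacterModule.dual (LinearMap.single R (fun _ => M) j) b, ?_, haF⟩
  intro i
  ext y
  have hA : A (Pi.single i y) = ∑ j, Pi.single j (a j i • y) := by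
    rw [Finset.univ_sum_single (fun j => a j i • y)]
    funext j
    simp [A, Pi.single_apply]
  have hl : c (Pi.single i y) = x i y := by
    rw [hcapply, Finset.sum_eq_single i (fun j _ hj => by rw [Pi.single_eq_of_ne hj, map_zero])
      (by simp), Pi.single_eq_same]
  rw [characterModule_sum_apply, ← hl, ← hb]
  change b (A (Pi.single i y)) = ∑ j, b (Pi.single j (a j i • y))
  rw [hA, map_sum]

lemma flat_double_characterModule [IsNoetherianRing R] [Module.Flat R M] :
    Module.Flat R (CharacterModule (CharacterModule M)) :=
  flat_characterModule_of_baer (Module.Flat.iff_characterModule_baer.mp inferInstance)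

/-- The cokernel of the evaluation map of a module is flat when its double character module is. -/
lemma flat_coker_characterModuleEval [Module.Flat R (CharacterModule (CharacterModule M))] :
    Module.Flat R
      (CharacterModule (CharacterModule M) ⧸ LinearMap.range (characterModuleEval R M)) := by
  rw [Module.Flat.iff_characterModule_baer]
  intro I φ
  let e := characterModuleEval R M
  let q := (LinearMap.range e).mkQ
  have hex : Function.Exact e q := LinearMap.exact_map_mkQ_range e
  obtain ⟨ψ, hψ⟩ := Module.Flat.iff_characterModule_baer.mp
    (inferInstanceAs (Module.Flat R (CharacterModule (CharacterModule M)))) I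
    (CharacterModule.dual q ∘ₗ φ)
  let p := CharacterModule.dual e
  let s := characterModuleEval R (CharacterModule M)
  have hs : ∀ c, p (s c) = c := fun _ => rfl
  obtain ⟨b, hb⟩ := exact_dual hex (ψ 1 - s (p (ψ 1))) (by
    change p _ = 0
    rw [map_sub, hs, sub_self])
  refine ⟨LinearMap.toSpanSingleton R _ b, fun x hx => ?_⟩
  apply CharacterModule.dual_injective_of_surjective q (Submodule.mkQ_surjective _)
  have hψx : ψ x = x • ψ 1 := by rw [← map_smul, smul_eq_mul, mul_one]
  have hp : p (ψ x) = 0 := by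
    rw [hψ x hx]
    ext m
    change φ ⟨x, hx⟩ (q (e m)) = 0
    rw [hex.apply_apply_eq_zero, map_zero]
  rw [LinearMap.toSpanSingleton_apply, map_smul, hb, smul_sub, ← hψx, ← map_smul, ← map_smul,
    ← hψx, hp, map_zero, sub_zero, hψ x hx]
  rfl

end DoubleDual

/-- Character modules are cotorsion. -/
lemma isCotorsion_characterModule (R : Type u) [CommRing R] (A : Type u) [AddCommGroup A]
    [Module R A] : IsCotorsion R (ModuleCat.of R (CharacterModule A)) := by
  intro G hG i hi
  obtain ⟨n, rfl⟩ : ∃ n, i = n + 1 := ⟨i - 1, by omega⟩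
  let P := projectiveResolution G
  let d : ∀ n, P.complex.X (n + 1) →ₗ[R] P.complex.X n := fun n => (P.complex.d (n + 1) n).hom
  have hd : ∀ n, Function.Exact (d (n + 1)) (d n) := fun n =>
    (ShortComplex.ShortExact.moduleCat_exact_iff_function_exact _).mp (P.exact_succ n)
  have hflat : ∀ n, Module.Flat R (P.complex.X n) := fun n => by
    have : Module.Projective R (P.complex.X n) :=
      (IsProjective.iff_projective _).mpr (P.projective n)
    infer_instance
  let ι : ∀ n, (P.complex.X (n + 1) ⧸ LinearMap.range (d (n + 1))) →ₗ[R] P.complex.X n := fun n =>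
    (LinearMap.range (d (n + 1))).liftQ (d n) (hd n).linearMap_ker_eq.ge
  have hι : ∀ n, Function.Injective (ι n) := fun n => by
    rw [← LinearMap.ker_eq_bot]
    exact Submodule.ker_liftQ_eq_bot _ _ _ (hd n).linearMap_ker_eq.le
  have hιex : ∀ n, Function.Exact (ι n) (LinearMap.range (d n)).mkQ := fun n => by
    rw [LinearMap.exact_iff, Submodule.ker_mkQ, Submodule.range_liftQ]
  have hQ : ∀ n, Module.Flat R (P.complex.X n ⧸ LinearMap.range (d n)) := by
    intro n
    induction n with
    | zero =>
      have h0 : Function.Exact (d 0) (P.π.f 0).hom :=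
        (ShortComplex.ShortExact.moduleCat_exact_iff_function_exact _).mp P.exact₀
      have hs : Function.Surjective (P.π.f 0).hom :=
        (ModuleCat.epi_iff_surjective (P.π.f 0)).mp inferInstance
      have : Module.Flat R (((ChainComplex.single₀ (ModuleCat.{u} R)).obj G).X 0) := hG
      exact Module.Flat.of_linearEquiv (h0.linearEquivOfSurjective hs)
    | succ n ih => exact flat_of_exact_of_flat_of_flat (hι n) (Submodule.mkQ_surjective _) (hιex n)
  refine ModuleCat.subsingleton_of_isZero (Limits.IsZero.of_iso ?_
    (P.isoExt (n + 1) (ModuleCat.of R (CharacterModule A))))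
  rw [← HomologicalComplex.exactAt_iff_isZero_homology,
    HomologicalComplex.exactAt_iff' _ n (n + 1) (n + 2) (by simp) (by simp),
    ShortComplex.moduleCat_exact_iff]
  intro (φ : P.complex.X (n + 1) ⟶ _) hφ
  have hφ' : P.complex.d (n + 2) (n + 1) ≫ φ = 0 := hφ
  let φ' := (LinearMap.range (d (n + 1))).liftQ φ.hom (by
    rintro _ ⟨y, rfl⟩
    exact congr(($hφ').hom y))
  obtain ⟨ψ, hψ⟩ := exists_extension_to_characterModule (hι n) (Submodule.mkQ_surjective _)
    (hιex n) φ'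
  refine ⟨ModuleCat.ofHom ψ, ?_⟩
  change P.complex.d (n + 1) n ≫ ModuleCat.ofHom ψ = φ
  refine ModuleCat.hom_ext (LinearMap.ext fun y => ?_)
  exact congr($hψ ((LinearMap.range (d (n + 1))).mkQ y))


/-- Every `C`-flat module `M` embeds in a short exact sequence
`0 → M → M₁ → M₂ → 0` with `M₁` `C`-flat `C`-cotorsion and `M₂` `C`-flat. -/
theorem stmt17 (R : Type u) [CommRing R] [IsNoetherianRing R]
    (C : ModuleCat.{u} R) (hC : IsSemidualizing R C) (M : ModuleCat.{u} R)
    (hM : IsCFlat R C M) :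
    ∃ (M₁ M₂ : ModuleCat.{u} R) (f : ↥M →ₗ[R] ↥M₁) (g : ↥M₁ →ₗ[R] ↥M₂),
      Function.Injective f ∧ Function.Surjective g ∧ Function.Exact f g ∧
      IsCFlatCotorsion R C M₁ ∧ IsCFlat R C M₂ := by
  obtain ⟨F, hF, ⟨e⟩⟩ := hM
  let j := characterModuleEval R F
  let q := (LinearMap.range j).mkQ
  have hF₁ : Module.Flat R (CharacterModule (CharacterModule F)) := flat_double_characterModule
  have hF₂ : Module.Flat R (CharacterModule (CharacterModule F) ⧸ LinearMap.range j) :=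
    flat_coker_characterModuleEval
  have hex : Function.Exact j q := LinearMap.exact_map_mkQ_range j
  have hq : Function.Surjective q := Submodule.mkQ_surjective _
  refine ⟨.of R (CharacterModule (CharacterModule F) ⊗[R] C),
    .of R ((CharacterModule (CharacterModule F) ⧸ LinearMap.range j) ⊗[R] C),
    j.rTensor C ∘ₗ e.toLinearMap, q.rTensor C, ?_, LinearMap.rTensor_surjective _ hq, ?_,
    ⟨.of R (CharacterModule (CharacterModule F)), hF₁, isCotorsion_characterModule R _,
      ⟨LinearEquiv.refl R _⟩⟩,
    ⟨.of R (CharacterModule (CharacterModule F) ⧸ LinearMap.range j), hF₂,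
      ⟨LinearEquiv.refl R _⟩⟩⟩
  · exact (rTensor_injective_of_exact_of_flat characterModuleEval_injective hq hex C).comp
      e.injective
  · rw [LinearMap.exact_iff, LinearMap.range_comp_of_range_eq_top _ e.range]
    exact (rTensor_exact C hex hq).linearMap_ker_eq
end
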